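/- arXiv:1901.02632 — 2 statements merged into one kernel-verified Lean document; each statement's English description precedes it below -/
import Mathlib

section
/- Value approximation: Let K be a field, t ∈ K^×, let S_1, …, S_n be sets of valuation rings of K, and let z_1, …, z_n ∈ K^×. Assume: (U) Assumption (U) holds for S = S_1 ∪ ⋯ ∪ S_n and t; (T) each S_i is compact in the topology T_{Zar*}; (I) the sets S_1, …, S_n are pairwise t-independent and pairwise incomparable. Then there exists z ∈ K^× with z·O_v = z_i·O_v for all v ∈ S_i, for i = 1, …, n, if and only if z_i·O_w = z_j·O_w for every valuation ring O_w of K having a refinement in S_i and a refinement in S_j. -/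
namespace PaperApprox

variable {K : Type*} [Field K]

/-- The "maximal ideal" `m_O = O \ O^×` of a ball `O`, where `O^× = O ∩ O⁻¹` and
`O⁻¹ = {x⁻¹ : 0 ≠ x ∈ O} = {x | x ≠ 0 ∧ x⁻¹ ∈ O}`. -/
def mball (O : Set K) : Set K := O \ (O ∩ {x | x ≠ 0 ∧ x⁻¹ ∈ O})

/-- The scaled set `z·S`. -/
def scale (z : K) (S : Set K) : Set K := {y | ∃ s ∈ S, y = z * s}

/-- A positive cone of a field ordering. -/
def IsOrderingCone (P : Set K) : Prop :=
  (∀ a ∈ P, ∀ b ∈ P, a + b ∈ P) ∧ (∀ a ∈ P, ∀ b ∈ P, a * b ∈ P) ∧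
    (∀ x : K, x ∈ P ∨ -x ∈ P) ∧ ∀ x : K, x ∈ P → -x ∈ P → x = 0

/-- `x ≤_P y` for a positive cone `P`. -/
def coneLE (P : Set K) (a b : K) : Prop := b - a ∈ P

/-- `x <_P y` for a positive cone `P`. -/
def coneLT (P : Set K) (a b : K) : Prop := b - a ∈ P ∧ a ≠ b

/-- The unit interval `{x : -1 ≤_P x ≤_P 1}` of an ordering. -/
def orderingBall (P : Set K) : Set K := {x | x + 1 ∈ P ∧ 1 - x ∈ P}

/-- `O` is the valuation ring of a (Krull) valuation on `K`. -/
def IsValuationLocality (O : Set K) : Prop := ∃ A : ValuationSubring K, O = (A : Set K)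

/-- `O` is the unit interval of a field ordering of `K`. -/
def IsOrderingLocality (O : Set K) : Prop := ∃ P : Set K, IsOrderingCone P ∧ O = orderingBall P

/-- `O` is the closed unit ball of an absolute value on `K`. -/
def IsAbsLocality (O : Set K) : Prop := ∃ f : AbsoluteValue K ℝ, O = {x | f x ≤ 1}

/-- A locality on `K`, identified with its ring/ball `O`. -/
def IsLocality (O : Set K) : Prop := IsValuationLocality O ∨ IsOrderingLocality O ∨ IsAbsLocality O

/-- `W` is the finest common coarsening of the localities `O₁`, `O₂`. -/
def IsFCC (O₁ O₂ W : Set K) : Prop :=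
  IsLocality W ∧ O₁ ⊆ W ∧ O₂ ⊆ W ∧ ∀ W', IsLocality W' → O₁ ⊆ W' → O₂ ⊆ W' → W ⊆ W'

/-- Two subsets `A`, `B` of `W` have the same image in the residue field `W/m_W`. -/
def SameResidue (W A B : Set K) : Prop :=
  (∀ x ∈ A, ∃ y ∈ B, x - y ∈ mball W) ∧ ∀ y ∈ B, ∃ x ∈ A, x - y ∈ mball W

/-- Incomparability of localities. -/
def Incomp (O₁ O₂ : Set K) : Prop := ¬O₁ ⊆ O₂ ∧ ¬O₂ ⊆ O₁

/-- Strong incomparability: incomparable, and the induced localities on the residue field of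
the finest common coarsening are distinct (their rings, i.e. the images of `O₁` and `O₂`,
differ). -/
def StronglyIncomp (O₁ O₂ : Set K) : Prop :=
  Incomp O₁ O₂ ∧ ∀ W, IsFCC O₁ O₂ W → ¬SameResidue W O₁ O₂

/-- `t`-independence of localities. -/
def TIndep (t : K) (O₁ O₂ : Set K) : Prop :=
  (∀ W, IsFCC O₁ O₂ W → t ∈ W ∧ t⁻¹ ∈ W) ∧
    (IsOrderingLocality O₁ → IsOrderingLocality O₂ → StronglyIncomp O₁ O₂)

/-- `t`-independence of valuation rings: `t` and `t⁻¹` lie in the smallest valuation ring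
containing both. -/
def TIndepVal (t : K) (O₁ O₂ : Set K) : Prop :=
  ∀ W : Set K, IsValuationLocality W → O₁ ⊆ W → O₂ ⊆ W →
    (∀ W', IsValuationLocality W' → O₁ ⊆ W' → O₂ ⊆ W' → W ⊆ W') → t ∈ W ∧ t⁻¹ ∈ W

/-- `t`-independence of sets of localities. -/
def SetTIndep (t : K) (S₁ S₂ : Set (Set K)) : Prop := ∀ v ∈ S₁, ∀ w ∈ S₂, TIndep t v w

/-- Incomparability of sets of localities. -/
def SetIncomp (S₁ S₂ : Set (Set K)) : Prop := ∀ v ∈ S₁, ∀ w ∈ S₂, Incomp v w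

/-- Independence of localities: the field topologies they induce on `K` (with the sets
`z·m_v`, `z ∈ K^×`, as neighbourhood bases of `0`) are distinct. -/
def IndepLoc (O₁ O₂ : Set K) : Prop :=
  ¬((∀ z : K, z ≠ 0 → ∃ z' : K, z' ≠ 0 ∧ scale z' (mball O₂) ⊆ scale z (mball O₁)) ∧
     ∀ z : K, z ≠ 0 → ∃ z' : K, z' ≠ 0 ∧ scale z' (mball O₁) ⊆ scale z (mball O₂))

/-- The Zariski topology on localities/balls of `K`. -/
def zarTop (K : Type*) [Field K] : TopologicalSpace (Set K) :=
  TopologicalSpace.generateFrom {U | ∃ x : K, U = {O : Set K | x ∈ O}}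

/-- The Hochster dual of the Zariski topology. -/
def zarStarTop (K : Type*) [Field K] : TopologicalSpace (Set K) :=
  TopologicalSpace.generateFrom {U | ∃ x : K, U = {O : Set K | x ∈ mball O}}

/-- The constructible topology. -/
def conTop (K : Type*) [Field K] : TopologicalSpace (Set K) :=
  TopologicalSpace.generateFrom
    ({U | ∃ x : K, U = {O : Set K | x ∈ O}} ∪ {U | ∃ x : K, U = {O : Set K | x ∈ mball O}})

/-- The Harrison topology on orderings (positive cones) of `K`. -/
def harrisonTop (K : Type*) [Field K] : TopologicalSpace (Set K) :=
  TopologicalSpace.generateFrom {U | ∃ x : K, x ≠ 0 ∧ U = {P : Set K | x ∈ P}}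

/-- Condition (i): `f(O) ⊆ O`. -/
def CondI (f : Polynomial K) (O : Set K) : Prop := ∀ x ∈ O, f.eval x ∈ O

/-- Condition (ii): `f(x) ∉ t·m_O` for `x ∈ O`. -/
def CondII (t : K) (f : Polynomial K) (O : Set K) : Prop := ∀ x ∈ O, f.eval x ∉ scale t (mball O)

/-- Condition (iii): `f(x) ∈ x^d (O \ t·m_O) ∩ (a_d x^d + x^(d-1) O)` for `x ∉ O`. -/
def CondIII (t : K) (f : Polynomial K) (O : Set K) : Prop :=
  ∀ x : K, x ∉ O →
    f.eval x ∈ scale (x ^ f.natDegree) (O \ scale t (mball O)) ∧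
      ∃ u ∈ O, f.eval x = f.leadingCoeff * x ^ f.natDegree + x ^ (f.natDegree - 1) * u

/-- Condition (iv): `O + O ⊆ t⁻¹·O`. -/
def CondIV (t : K) (O : Set K) : Prop := ∀ a ∈ O, ∀ b ∈ O, a + b ∈ scale t⁻¹ O

/-- Assumption (U) for a set `S` of localities and `t ∈ K^×`. -/
def AssumptionU (S : Set (Set K)) (t : K) : Prop :=
  ∃ f : Polynomial K, 2 ≤ f.natDegree ∧
    ∀ v ∈ S, CondI f v ∧ CondII t f v ∧ CondIII t f v ∧ CondIV t v

/-- Assumption (U-exc) for finitely many sets `S 1, …, S n` of localities and `t ∈ K^×`: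
conditions (i), (iii), (iv) everywhere, and condition (ii) on the infinite `S i`. -/
def AssumptionUExc {n : ℕ} (S : Fin n → Set (Set K)) (t : K) : Prop :=
  ∃ f : Polynomial K, 2 ≤ f.natDegree ∧
    (∀ i, ∀ v ∈ S i, CondI f v ∧ CondIII t f v ∧ CondIV t v) ∧
      ∀ i, (S i).Infinite → ∀ v ∈ S i, CondII t f v

/-- `S_π^e(K)`: valuation rings whose value group has a smallest positive element `γ`
(multiplicatively: a largest element `γ < 1`), such that `ℤγ` is convex and
`0 < v(π) ≤ eγ` (multiplicatively `γ^e ≤ v(π) < 1`). -/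
def SPiE (π : K) (e : ℕ) : Set (Set K) :=
  {O | ∃ A : ValuationSubring K, O = (A : Set K) ∧
    ∃ γ : A.ValueGroup, γ ≠ 0 ∧ γ < 1 ∧
      (∀ δ : A.ValueGroup, δ ≠ 0 → δ < 1 → δ ≤ γ) ∧
      (∀ δ : A.ValueGroup, δ ≠ 0 → ∀ m n : ℤ, γ ^ m ≤ δ → δ ≤ γ ^ n → ∃ k : ℤ, δ = γ ^ k) ∧
      A.valuation π < 1 ∧ γ ^ e ≤ A.valuation π}

/-- `O_w` is convex with respect to the ordering with positive cone `P`. -/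
def ConvexWrtOrdering (P W : Set K) : Prop :=
  ∀ u w : K, u ∈ P → w - u ∈ P → w ∈ W → u ∈ W

/-- Iterated application `φ(x₁, φ(x₂, …))`. -/
def iterPhi (φ : K → K → K) : K → List K → K
  | x, [] => x
  | x, y :: l => φ x (iterPhi φ y l)



/-- the homogenisation of `f` -/
noncomputable def hom {K : Type*} [Field K] (f : Polynomial K) (x y : K) : K :=
  y ^ f.natDegree * f.eval (x / y)

theorem mem_mball {K : Type*} [Field K] (A : ValuationSubring K) (x : K) :
    x ∈ mball (A : Set K) ↔ A.valuation x < 1 := by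
  unfold mball
  by_cases hx : x = 0
  · subst hx; simp
  · have h0 : 0 < A.valuation x := by
      rw [zero_lt_iff]; exact (Valuation.ne_zero_iff _).2 hx
    simp only [Set.mem_diff, Set.mem_inter_iff, SetLike.mem_coe, Set.mem_setOf_eq,
      ← A.valuation_le_one_iff, map_inv₀, inv_le_one₀ h0]
    constructor
    · rintro ⟨h1, h2⟩
      by_contra h
      exact h2 ⟨h1, hx, not_lt.1 h⟩
    · intro h
      exact ⟨h.le, fun h' => absurd h'.2.2 (not_le.2 h)⟩

/-- The good conditions at a valuation ring. -/
def Good {K : Type*} [Field K] (t : K) (f : Polynomial K) (A : ValuationSubring K) : Prop :=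
  A.valuation t ≤ 1 ∧ ∀ x y : K, x ≠ 0 → y ≠ 0 →
    hom f x y ≠ 0 ∧
    A.valuation (hom f x y) ≤ max (A.valuation x) (A.valuation y) ^ f.natDegree ∧
    A.valuation t * max (A.valuation x) (A.valuation y) ^ f.natDegree ≤ A.valuation (hom f x y)

theorem not_mem_scale {K : Type*} [Field K] (A : ValuationSubring K) (t x : K) (ht : t ≠ 0)
    (h : x ∉ scale t (mball (A : Set K))) : A.valuation t ≤ A.valuation x := by
  by_contra hlt
  rw [not_le] at hlt
  apply h
  refine ⟨x / t, ?_, by field_simp⟩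
  rw [mem_mball, map_div₀]
  have h0 : 0 < A.valuation t := by
    rw [zero_lt_iff]; exact (Valuation.ne_zero_iff _).2 ht
  exact (div_lt_one₀ h0).2 hlt

theorem good_of {K : Type*} [Field K] (t : K) (ht : t ≠ 0) (f : Polynomial K)
    (A : ValuationSubring K)
    (h1 : CondI f (A : Set K)) (h2 : CondII t f (A : Set K)) (h3 : CondIII t f (A : Set K))
    (h4 : CondIV t (A : Set K)) : Good t f A := by
  have ht0 : 0 < A.valuation t := by
    rw [zero_lt_iff]; exact (Valuation.ne_zero_iff _).2 ht
  refine ⟨?_, ?_⟩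
  · obtain ⟨s, hs, h⟩ := h4 1 A.one_mem 0 A.zero_mem
    rw [A.valuation_le_one_iff]
    have : s = t := by field_simp at h; simpa using h.symm
    rw [← this]; exact hs
  · intro x y hx hy
    have hy0 : 0 < A.valuation y := by
      rw [zero_lt_iff]; exact (Valuation.ne_zero_iff _).2 hy
    have hx0 : 0 < A.valuation x := by
      rw [zero_lt_iff]; exact (Valuation.ne_zero_iff _).2 hx
    have key : A.valuation (hom f x y) ≤ max (A.valuation x) (A.valuation y) ^ f.natDegree ∧
      A.valuation t * max (A.valuation x) (A.valuation y) ^ f.natDegree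
        ≤ A.valuation (hom f x y) := by
      unfold hom
      by_cases hm : x / y ∈ A
      · have hle : A.valuation x ≤ A.valuation y := by
          rw [← A.valuation_le_one_iff, map_div₀, div_le_one₀ hy0] at hm
          exact hm
        rw [max_eq_right hle, map_mul, map_pow]
        have e1 := (A.valuation_le_one_iff _).2 (h1 _ hm)
        have e2 := not_mem_scale A t _ ht (h2 _ hm)
        constructor
        · exact mul_le_of_le_one_right' e1
        · rw [mul_comm]; gcongr
      · have hle : A.valuation y ≤ A.valuation x := by
          rw [← A.valuation_le_one_iff, map_div₀, div_le_one₀ hy0] at hm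
          exact (not_le.1 hm).le
        rw [max_eq_left hle]
        obtain ⟨⟨s, ⟨hs1, hs2⟩, hs⟩, -⟩ := h3 _ hm
        have e1 := (A.valuation_le_one_iff _).2 hs1
        have e2 := not_mem_scale A t _ ht hs2
        have : y ^ f.natDegree * f.eval (x / y) = x ^ f.natDegree * s := by
          rw [hs, div_pow]; field_simp
        rw [this, map_mul, map_pow]
        constructor
        · exact mul_le_of_le_one_right' e1
        · rw [mul_comm]; gcongr
    refine ⟨?_, key⟩
    intro h
    have := key.2
    rw [h, map_zero] at this
    have h2 : 0 < A.valuation t * max (A.valuation x) (A.valuation y) ^ f.natDegree :=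
      mul_pos ht0 (pow_pos (lt_max_of_lt_left hx0) _)
    exact absurd this (not_le.2 h2)

/-- product of two valuation rings -/
def prodVal {K : Type*} [Field K] (A B : ValuationSubring K) : ValuationSubring K where
  carrier := {x | ∃ a ∈ A, ∃ b ∈ B, x = a * b}
  mul_mem' := by
    rintro _ _ ⟨a, ha, b, hb, rfl⟩ ⟨a', ha', b', hb', rfl⟩
    exact ⟨a * a', A.mul_mem _ _ ha ha', b * b', B.mul_mem _ _ hb hb', by ring⟩
  one_mem' := ⟨1, A.one_mem, 1, B.one_mem, by simp⟩
  zero_mem' := ⟨0, A.zero_mem, 0, B.zero_mem, by simp⟩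
  neg_mem' := by
    rintro _ ⟨a, ha, b, hb, rfl⟩
    exact ⟨-a, A.neg_mem _ ha, b, hb, by ring⟩
  add_mem' := by
    rintro _ _ ⟨a, ha, b, hb, rfl⟩ ⟨a', ha', b', hb', rfl⟩
    by_cases h0 : b = 0
    · exact ⟨a', ha', b', hb', by simp [h0]⟩
    by_cases h0' : b' = 0
    · exact ⟨a, ha, b, hb, by simp [h0']⟩
    rcases A.mem_or_inv_mem (b / b') with h | h
    · exact ⟨a * (b / b') + a', A.add_mem _ _ (A.mul_mem _ _ ha h) ha', b', hb', by field_simp⟩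
    · exact ⟨a + a' * (b / b')⁻¹, A.add_mem _ _ ha (A.mul_mem _ _ ha' h), b, hb, by field_simp⟩
  mem_or_inv_mem' := by
    intro x
    rcases A.mem_or_inv_mem x with h | h
    · exact Or.inl ⟨x, h, 1, B.one_mem, by simp⟩
    · exact Or.inr ⟨x⁻¹, h, 1, B.one_mem, by simp⟩

theorem mem_prodVal {K : Type*} [Field K] (A B : ValuationSubring K) (x : K) :
    x ∈ prodVal A B ↔ ∃ a ∈ A, ∃ b ∈ B, x = a * b := Iff.rfl

theorem left_le {K : Type*} [Field K] (A B : ValuationSubring K) :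
    (A : Set K) ⊆ prodVal A B := fun x h => ⟨x, h, 1, B.one_mem, by simp⟩

theorem right_le {K : Type*} [Field K] (A B : ValuationSubring K) :
    (B : Set K) ⊆ prodVal A B := fun x h => ⟨1, A.one_mem, x, h, by simp⟩

theorem val_inv_lt_one {K : Type*} [Field K] (A : ValuationSubring K) (x : K) (h : x ∉ A) :
    A.valuation x⁻¹ < 1 := by
  rw [← A.valuation_le_one_iff, not_le] at h
  rw [map_inv₀]
  exact inv_lt_one_of_one_lt₀ h

theorem pointwise {K : Type*} [Field K] (A B : ValuationSubring K)
    (hinc : Incomp (A : Set K) (B : Set K)) (c : K) (hc : c ≠ 0)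
    (hcW : c⁻¹ ∈ prodVal A B) :
    ∃ x : K, x ≠ 0 ∧ A.valuation (x / c) < 1 ∧ B.valuation (x⁻¹ / c) < 1 := by
  obtain ⟨h1, h2⟩ := hinc
  obtain ⟨r, hrA, hrB⟩ := Set.not_subset.1 h1
  obtain ⟨s, hsB, hsA⟩ := Set.not_subset.1 h2
  have hr0 : r ≠ 0 := by rintro rfl; exact hrB B.zero_mem
  have hs0 : s ≠ 0 := by rintro rfl; exact hsA A.zero_mem
  obtain ⟨a, ha, b, hb, hab⟩ := (prodVal A B).mul_mem _ _ hcW hcW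
  have hne : a * b ≠ 0 := by rw [← hab]; positivity
  have ha0 : a ≠ 0 := left_ne_zero_of_mul hne
  have hb0 : b ≠ 0 := right_ne_zero_of_mul hne
  refine ⟨c * (a * r * s⁻¹), by positivity, ?_, ?_⟩
  · have : c * (a * r * s⁻¹) / c = (a * r) * s⁻¹ := by field_simp
    rw [this, map_mul]
    exact (mul_le_of_le_one_left' ((A.valuation_le_one_iff _).2 (A.mul_mem _ _ ha hrA))).trans_lt
      (val_inv_lt_one A s hsA)
  · have : (c * (a * r * s⁻¹))⁻¹ / c = (b * s) * r⁻¹ := by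
      have : (c * (a * r * s⁻¹))⁻¹ / c = (c⁻¹ * c⁻¹) * (a⁻¹ * s * r⁻¹) := by field_simp
      rw [this, hab]; field_simp
    rw [this, map_mul]
    exact (mul_le_of_le_one_left' ((B.valuation_le_one_iff _).2 (B.mul_mem _ _ hb hsB))).trans_lt
      (val_inv_lt_one B r hrB)

section
variable {K : Type*} [Field K] {t : K} {f : Polynomial K} {A : ValuationSubring K}

theorem vpos (A : ValuationSubring K) {x : K} (hx : x ≠ 0) : 0 < A.valuation x := by
  rw [zero_lt_iff]; exact (Valuation.ne_zero_iff _).2 hx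

theorem div_lt_iff' (A : ValuationSubring K) {x c : K} (hc : c ≠ 0) :
    A.valuation (x / c) < 1 ↔ A.valuation x < A.valuation c := by
  rw [map_div₀]; exact div_lt_one₀ (vpos A hc)

theorem hom_small (hg : Good t f A) (hd : 2 ≤ f.natDegree) {c x y : K} (hc : c ≠ 0)
    (hc1 : A.valuation c ≤ 1)
    (hx0 : x ≠ 0) (hy0 : y ≠ 0) (hx : A.valuation (x / c) < 1) (hy : A.valuation (y / c) < 1) :
    A.valuation (hom f x y / c) < 1 := by
  rw [div_lt_iff' A hc] at *
  have hm := max_lt hx hy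
  refine lt_of_le_of_lt (hg.2 x y hx0 hy0).2.1 (lt_of_le_of_lt ?_ hm)
  exact pow_le_of_le_one zero_le (hm.le.trans hc1) (by omega)

theorem hom_big (ht : t ≠ 0) (hg : Good t f A) (hd : 2 ≤ f.natDegree) {c x y : K} (hc : c ≠ 0)
    (hc1 : A.valuation c ≤ A.valuation t)
    (hx0 : x ≠ 0) (hy0 : y ≠ 0)
    (h : A.valuation (x⁻¹ / c) < 1 ∨ A.valuation (y⁻¹ / c) < 1) :
    A.valuation ((hom f x y)⁻¹ / c) < 1 := by
  obtain ⟨h0, -, h2⟩ := hg.2 x y hx0 hy0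
  have e : ∀ x : K, x ≠ 0 → (A.valuation (x⁻¹ / c) < 1 ↔ 1 < A.valuation c * A.valuation x) := by
    intro x hx
    rw [div_lt_iff' A hc, map_inv₀, inv_lt_iff_one_lt_mul₀ (vpos A hx), mul_comm]
  rw [e _ h0]
  rw [e _ hx0, e _ hy0] at h
  set M := max (A.valuation x) (A.valuation y) with hM
  have hcM : 1 < A.valuation c * M := by
    rcases h with h | h
    · exact h.trans_le (by gcongr; exact le_max_left _ _)
    · exact h.trans_le (by gcongr; exact le_max_right _ _)
  have htM : 1 ≤ A.valuation t * M := hcM.le.trans (by gcongr)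
  have hM1 : 1 ≤ M := htM.trans (mul_le_of_le_one_left' hg.1)
  have : M ≤ A.valuation (hom f x y) := by
    refine le_trans ?_ h2
    calc M ≤ (A.valuation t * M) * M := le_mul_of_one_le_left' htM
      _ = A.valuation t * M ^ 2 := by rw [mul_assoc, sq]
      _ ≤ _ := by gcongr
  exact hcM.trans_le (by gcongr)

end


section
variable {K : Type*} [Field K]

theorem isOpen_small (x : K) : @IsOpen (Set K) (zarStarTop K) {O : Set K | x ∈ mball O} :=
  TopologicalSpace.isOpen_generateFrom_of_mem ⟨x, rfl⟩

theorem global_sep (t : K) (ht : t ≠ 0) (f : Polynomial K) (hd : 2 ≤ f.natDegree)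
    (S T : Set (Set K))
    (hS : ∀ v ∈ S, ∃ A : ValuationSubring K, v = A ∧ Good t f A)
    (hT : ∀ v ∈ T, ∃ A : ValuationSubring K, v = A ∧ Good t f A)
    (cS : @IsCompact (Set K) (zarStarTop K) S) (cT : @IsCompact (Set K) (zarStarTop K) T)
    (hSne : S.Nonempty) (hTne : T.Nonempty)
    (hinc : SetIncomp S T) (c : K) (hc : c ≠ 0)
    (hcS : ∀ A : ValuationSubring K, (A : Set K) ∈ S ∪ T → A.valuation c ≤ A.valuation t)
    (hcW : ∀ A B : ValuationSubring K, (A : Set K) ∈ S → (B : Set K) ∈ T → c⁻¹ ∈ prodVal A B) :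
    ∃ x : K, x ≠ 0 ∧ (∀ v ∈ S, x / c ∈ mball v) ∧ ∀ w ∈ T, x⁻¹ / c ∈ mball w := by
  letI := zarStarTop K
  have pw : ∀ v ∈ S, ∀ w ∈ T, ∃ x : K, x ≠ 0 ∧ x / c ∈ mball v ∧ x⁻¹ / c ∈ mball w := by
    intro v hv w hw
    obtain ⟨A, rfl, hA⟩ := hS v hv
    obtain ⟨B, rfl, hB⟩ := hT w hw
    simp only [mem_mball]
    exact pointwise A B (hinc _ hv _ hw) c hc (hcW A B hv hw)
  obtain ⟨v0, hv0⟩ := hSne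
  obtain ⟨w0, hw0⟩ := hTne
  have step1 : ∀ v ∈ S, ∃ x : K, x ≠ 0 ∧ x / c ∈ mball v ∧ ∀ w ∈ T, x⁻¹ / c ∈ mball w := by
    intro v hv
    suffices h : ∃ x : K, x ≠ 0 ∧ x / c ∈ mball v ∧ ∀ w ∈ T, w ∈ T → x⁻¹ / c ∈ mball w by
      obtain ⟨x, h0, h1, h2⟩ := h
      exact ⟨x, h0, h1, fun w hw => h2 w hw hw⟩
    refine cT.induction_on
      (p := fun s => ∃ x : K, x ≠ 0 ∧ x / c ∈ mball v ∧ ∀ w ∈ s, w ∈ T → x⁻¹ / c ∈ mball w)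
      ?_ ?_ ?_ ?_
    · obtain ⟨x, h0, h1, h2⟩ := pw v hv w0 hw0
      exact ⟨x, h0, h1, by simp⟩
    · rintro s s' hss ⟨x, h0, h1, h2⟩
      exact ⟨x, h0, h1, fun w hw => h2 w (hss hw)⟩
    · rintro s s' ⟨x, h0, h1, h2⟩ ⟨y, k0, k1, k2⟩
      obtain ⟨A, rfl, hA⟩ := hS v hv
      refine ⟨hom f x y, (hA.2 x y h0 k0).1, ?_, ?_⟩
      · rw [mem_mball] at *
        exact hom_small hA hd hc ((hcS A (Or.inl hv)).trans hA.1) h0 k0 h1 k1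
      · intro w hw hwT
        obtain ⟨B, rfl, hB⟩ := hT w hwT
        rw [mem_mball]
        refine hom_big ht hB hd hc (hcS B (Or.inr hwT)) h0 k0 ?_
        rcases hw with hw | hw
        · exact Or.inl ((mem_mball _ _).1 (h2 _ hw hwT))
        · exact Or.inr ((mem_mball _ _).1 (k2 _ hw hwT))
    · intro w hw
      obtain ⟨x, h0, h1, h2⟩ := pw v hv w hw
      exact ⟨_, mem_nhdsWithin_of_mem_nhds ((isOpen_small (x⁻¹ / c)).mem_nhds h2),
        x, h0, h1, fun w' hw' _ => hw'⟩
  suffices h : ∃ x : K, x ≠ 0 ∧ (∀ v ∈ S, v ∈ S → x / c ∈ mball v) ∧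
      ∀ w ∈ T, x⁻¹ / c ∈ mball w by
    obtain ⟨x, h0, h1, h2⟩ := h
    exact ⟨x, h0, fun w hw => h1 w hw hw, h2⟩
  refine cS.induction_on
    (p := fun s => ∃ x : K, x ≠ 0 ∧ (∀ v ∈ s, v ∈ S → x / c ∈ mball v) ∧
      ∀ w ∈ T, x⁻¹ / c ∈ mball w)
    ?_ ?_ ?_ ?_
  · obtain ⟨x, h0, h1, h2⟩ := step1 v0 hv0
    exact ⟨x, h0, by simp, h2⟩
  · rintro s s' hss ⟨x, h0, h1, h2⟩
    exact ⟨x, h0, fun w hw => h1 w (hss hw), h2⟩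
  · rintro s s' ⟨x, h0, h1, h2⟩ ⟨y, k0, k1, k2⟩
    have h0' := inv_ne_zero h0
    have k0' := inv_ne_zero k0
    obtain ⟨A0, -, hA0⟩ := hS v0 hv0
    refine ⟨(hom f x⁻¹ y⁻¹)⁻¹, inv_ne_zero (hA0.2 _ _ h0' k0').1, ?_, ?_⟩
    · intro v hv hvS
      obtain ⟨A, rfl, hA⟩ := hS v hvS
      rw [mem_mball]
      refine hom_big ht hA hd hc (hcS A (Or.inl hvS)) h0' k0' ?_
      rw [inv_inv, inv_inv]
      rcases hv with hv | hv
      · exact Or.inl ((mem_mball _ _).1 (h1 _ hv hvS))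
      · exact Or.inr ((mem_mball _ _).1 (k1 _ hv hvS))
    · intro w hw
      obtain ⟨B, rfl, hB⟩ := hT w hw
      rw [mem_mball, inv_inv]
      exact hom_small hB hd hc ((hcS B (Or.inr hw)).trans hB.1) h0' k0'
        ((mem_mball _ _).1 (h2 _ hw)) ((mem_mball _ _).1 (k2 _ hw))
  · intro v hv
    obtain ⟨x, h0, h1, h2⟩ := step1 v hv
    exact ⟨_, mem_nhdsWithin_of_mem_nhds ((isOpen_small (x / c)).mem_nhds h1),
      x, h0, fun w' hw' _ => hw', h2⟩

theorem c_bound {t : K} {f : Polynomial K} {A : ValuationSubring K} (ht : t ≠ 0)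
    (hg : Good t f A) (hd : 2 ≤ f.natDegree) {a : K} (ha : a ≠ 0) :
    A.valuation (t ^ 2 / hom f a a⁻¹) ≤ A.valuation t ∧
    A.valuation (t ^ 2 / hom f a a⁻¹) * A.valuation a ≤ 1 ∧
    A.valuation (t ^ 2 / hom f a a⁻¹) ≤ A.valuation a := by
  obtain ⟨h0, -, h2⟩ := hg.2 a a⁻¹ ha (inv_ne_zero ha)
  set c := t ^ 2 / hom f a a⁻¹ with hc
  set M := max (A.valuation a) (A.valuation a⁻¹) with hM
  have hav := vpos A ha
  have hM1 : 1 ≤ M := by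
    rcases le_total 1 (A.valuation a) with h | h
    · exact h.trans (le_max_left _ _)
    · refine le_trans ?_ (le_max_right _ _)
      rw [map_inv₀]; exact (one_le_inv₀ hav).2 h
  have e : A.valuation c * A.valuation (hom f a a⁻¹) = A.valuation t * A.valuation t := by
    rw [← map_mul, ← map_mul, hc, div_mul_cancel₀ _ h0, sq]
  have k : A.valuation c * M ≤ A.valuation t := by
    have : A.valuation t * (A.valuation c * M) ≤ A.valuation t * A.valuation t := by
      calc A.valuation t * (A.valuation c * M) = A.valuation c * (A.valuation t * M) := by
            rw [mul_left_comm]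
        _ ≤ A.valuation c * (A.valuation t * M ^ f.natDegree) := by
            gcongr; exact le_self_pow₀ hM1 (by omega)
        _ ≤ _ := by rw [← e]; gcongr
    exact le_of_mul_le_mul_left this (vpos A ht)
  refine ⟨(le_mul_of_one_le_right' hM1).trans k, ?_, ?_⟩
  · refine le_trans ?_ (k.trans hg.1)
    gcongr; exact le_max_left _ _
  · have : A.valuation c * A.valuation a⁻¹ ≤ 1 := by
      refine le_trans ?_ (k.trans hg.1)
      gcongr; exact le_max_right _ _
    rwa [map_inv₀, ← div_eq_mul_inv, div_le_one₀ hav] at this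

theorem hom_mem {t : K} {f : Polynomial K} {A : ValuationSubring K}
    (hg : Good t f A) {a : K} (ha : a ≠ 0) (W : ValuationSubring K) (hAW : (A : Set K) ⊆ W)
    (h1 : a ∈ W) (h2 : a⁻¹ ∈ W) : hom f a a⁻¹ ∈ W := by
  obtain ⟨-, h, -⟩ := hg.2 a a⁻¹ ha (inv_ne_zero ha)
  have key : ∀ b : K, b ≠ 0 → b ∈ W → A.valuation (hom f a a⁻¹) ≤ A.valuation b ^ f.natDegree →
      hom f a a⁻¹ ∈ W := by
    intro b hb hbW hle
    have : hom f a a⁻¹ = (hom f a a⁻¹ / b ^ f.natDegree) * b ^ f.natDegree := by field_simp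
    rw [this]
    refine W.mul_mem _ _ (hAW ?_) (pow_mem hbW _)
    rw [SetLike.mem_coe, ← A.valuation_le_one_iff, map_div₀, map_pow]
    exact (div_le_one₀ (pow_pos (vpos A hb) _)).2 hle
  rcases max_choice (A.valuation a) (A.valuation a⁻¹) with hm | hm <;> rw [hm] at h
  · exact key a ha h1 h
  · exact key _ (inv_ne_zero ha) h2 h

theorem two_sets (t : K) (ht : t ≠ 0) (f : Polynomial K) (hd : 2 ≤ f.natDegree)
    (S T : Set (Set K))
    (hS : ∀ v ∈ S, ∃ A : ValuationSubring K, v = A ∧ Good t f A)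
    (hT : ∀ v ∈ T, ∃ A : ValuationSubring K, v = A ∧ Good t f A)
    (cS : @IsCompact (Set K) (zarStarTop K) S) (cT : @IsCompact (Set K) (zarStarTop K) T)
    (hti : ∀ v ∈ S, ∀ w ∈ T, TIndepVal t v w)
    (hinc : SetIncomp S T) (a : K) (ha : a ≠ 0)
    (haW : ∀ W : ValuationSubring K, (∃ v ∈ S, v ⊆ (W : Set K)) → (∃ v ∈ T, v ⊆ (W : Set K)) →
      a ∈ W ∧ a⁻¹ ∈ W) :
    ∃ z : K, z ≠ 0 ∧ (∀ A : ValuationSubring K, (A : Set K) ∈ S → A.valuation z = 1) ∧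
      ∀ A : ValuationSubring K, (A : Set K) ∈ T → A.valuation z = A.valuation a := by
  rcases S.eq_empty_or_nonempty with rfl | hSne
  · exact ⟨a, ha, by simp, fun _ _ => rfl⟩
  rcases T.eq_empty_or_nonempty with rfl | hTne
  · exact ⟨1, one_ne_zero, by simp, by simp⟩
  have good : ∀ A : ValuationSubring K, (A : Set K) ∈ S ∪ T → Good t f A := by
    rintro A (h | h)
    · obtain ⟨B, hB, hg⟩ := hS _ h
      rwa [SetLike.coe_injective hB]
    · obtain ⟨B, hB, hg⟩ := hT _ h
      rwa [SetLike.coe_injective hB]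
  set c := t ^ 2 / hom f a a⁻¹ with hcdef
  obtain ⟨v0, hv0⟩ := id hSne
  obtain ⟨A0, hA0, hg0⟩ := hS v0 hv0
  have hh0 : hom f a a⁻¹ ≠ 0 := (hg0.2 a a⁻¹ ha (inv_ne_zero ha)).1
  have hc : c ≠ 0 := div_ne_zero (pow_ne_zero _ ht) hh0
  have cb : ∀ A : ValuationSubring K, (A : Set K) ∈ S ∪ T → _ := fun A hA =>
    c_bound ht (good A hA) hd ha
  rw [← hcdef] at cb
  obtain ⟨x, hx0, hxS, hxT⟩ := global_sep t ht f hd S T hS hT cS cT hSne hTne hinc c hc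
    (fun A hA => (cb A hA).1) (by
      intro A B hA hB
      obtain ⟨h1, h2⟩ := haW (prodVal A B) ⟨A, hA, left_le A B⟩ ⟨B, hB, right_le A B⟩
      obtain ⟨-, h3⟩ := hti _ hA _ hB (prodVal A B) ⟨_, rfl⟩ (left_le A B) (right_le A B) (by
        rintro _ ⟨W, rfl⟩ hAW hBW _ ⟨p, hp, q, hq, rfl⟩
        exact W.mul_mem _ _ (hAW hp) (hBW hq))
      have h4 := hom_mem (good A (Or.inl hA)) ha (prodVal A B) (left_le A B) h1 h2
      have : c⁻¹ = hom f a a⁻¹ * (t⁻¹ * t⁻¹) := by rw [hcdef]; field_simp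
      rw [this]
      exact mul_mem h4 (mul_mem h3 h3))
  have vS : ∀ A : ValuationSubring K, (A : Set K) ∈ S →
      A.valuation (1 + x) = 1 ∧ A.valuation (1 + a * x) = 1 := by
    intro A hA
    have h := hxS _ hA
    rw [mem_mball, div_lt_iff' A hc] at h
    obtain ⟨c1, c2, c3⟩ := cb A (Or.inl hA)
    refine ⟨Valuation.map_one_add_of_lt _ (h.trans_le (c1.trans (good A (Or.inl hA)).1)),
      Valuation.map_one_add_of_lt _ ?_⟩
    rw [map_mul]
    refine lt_of_lt_of_le ?_ c2
    rw [mul_comm]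
    exact mul_lt_mul_of_pos_right h (vpos A ha)
  have vT : ∀ A : ValuationSubring K, (A : Set K) ∈ T →
      A.valuation (1 + x) = A.valuation x ∧
      A.valuation (1 + a * x) = A.valuation a * A.valuation x := by
    intro A hA
    have h := hxT _ hA
    rw [mem_mball, div_lt_iff' A hc, map_inv₀, inv_lt_iff_one_lt_mul₀ (vpos A hx0)] at h
    obtain ⟨c1, c2, c3⟩ := cb A (Or.inr hA)
    have e1 : 1 < A.valuation x :=
      h.trans_le (mul_le_of_le_one_left' (c1.trans (good A (Or.inr hA)).1))
    have e2 : 1 < A.valuation (a * x) := by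
      rw [map_mul]
      exact h.trans_le (by gcongr)
    constructor
    · apply Valuation.map_add_eq_of_lt_right
      rwa [map_one]
    · rw [← map_mul]
      apply Valuation.map_add_eq_of_lt_right
      rwa [map_one]
  have hA0S : (A0 : Set K) ∈ S := hA0 ▸ hv0
  have n1 : 1 + x ≠ 0 := by
    intro h
    have := (vS A0 hA0S).1
    rw [h, map_zero] at this
    exact zero_ne_one this
  have n2 : 1 + a * x ≠ 0 := by
    intro h
    have := (vS A0 hA0S).2
    rw [h, map_zero] at this
    exact zero_ne_one this
  refine ⟨(1 + a * x) / (1 + x), div_ne_zero n2 n1, ?_, ?_⟩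
  · intro A hA
    rw [map_div₀, (vS A hA).1, (vS A hA).2, div_one]
  · intro A hA
    rw [map_div₀, (vT A hA).1, (vT A hA).2, mul_div_cancel_right₀ _ (vpos A hx0).ne']

theorem scale_eq_iff (A : ValuationSubring K) (x y : K) (hx : x ≠ 0) (hy : y ≠ 0) :
    scale x (A : Set K) = scale y (A : Set K) ↔ A.valuation x = A.valuation y := by
  have key : ∀ x y : K, x ≠ 0 → y ≠ 0 →
      (scale x (A : Set K) ⊆ scale y (A : Set K) ↔ A.valuation x ≤ A.valuation y) := by
    intro x y hx hy
    rw [← div_le_one₀ (vpos A hy), ← map_div₀, A.valuation_le_one_iff]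
    constructor
    · intro h
      obtain ⟨s, hs, e⟩ := h ⟨1, A.one_mem, (mul_one x).symm⟩
      have : x / y = s := by rw [e]; field_simp
      rw [this]; exact hs
    · rintro h _ ⟨s, hs, rfl⟩
      exact ⟨x / y * s, A.mul_mem _ _ h hs, by field_simp⟩
  rw [Set.Subset.antisymm_iff, key x y hx hy, key y x hy hx, le_antisymm_iff]

theorem val_eq_iff (A : ValuationSubring K) (x y : K) (hx : x ≠ 0) (hy : y ≠ 0) :
    A.valuation x = A.valuation y ↔ x / y ∈ A ∧ (x / y)⁻¹ ∈ A := by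
  rw [inv_div, ← A.valuation_le_one_iff, ← A.valuation_le_one_iff, map_div₀, map_div₀,
    div_le_one₀ (vpos A hy), div_le_one₀ (vpos A hx), le_antisymm_iff]

theorem scale_coarsen (A W : ValuationSubring K) (h : (A : Set K) ⊆ W) (x y : K)
    (hx : x ≠ 0) (hy : y ≠ 0) (e : scale x (A : Set K) = scale y (A : Set K)) :
    scale x (W : Set K) = scale y (W : Set K) := by
  rw [scale_eq_iff _ _ _ hx hy, val_eq_iff _ _ _ hx hy] at *
  exact ⟨h e.1, h e.2⟩

end

/-- **Corollary 5.1** (value approximation): a common `z` with `z·O_v = z_i·O_v` on each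
`S i` exists iff the `z i` are compatible at all common coarsenings. -/
theorem value_approximation {K : Type*} [Field K] (t : K) (ht : t ≠ 0)
    (n : ℕ) (S : Fin n → Set (Set K))
    (hval : ∀ i, ∀ v ∈ S i, IsValuationLocality v)
    (z : Fin n → K) (hz : ∀ i, z i ≠ 0)
    (hU : AssumptionU (⋃ i, S i) t)
    (hT : ∀ i, @IsCompact (Set K) (zarStarTop K) (S i))
    (hti : ∀ i j, i ≠ j → ∀ v ∈ S i, ∀ w ∈ S j, TIndepVal t v w)
    (hinc : ∀ i j, i ≠ j → SetIncomp (S i) (S j)) :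
    (∃ ζ : K, ζ ≠ 0 ∧ ∀ i, ∀ v ∈ S i, scale ζ v = scale (z i) v) ↔
      ∀ i j, ∀ W : Set K, IsValuationLocality W →
        (∃ v ∈ S i, v ⊆ W) → (∃ v ∈ S j, v ⊆ W) → scale (z i) W = scale (z j) W := by
  constructor
  · rintro ⟨ζ, hζ, h⟩ i j W ⟨W, rfl⟩ ⟨v, hv, hvW⟩ ⟨w, hw, hwW⟩
    obtain ⟨A, rfl⟩ := hval i v hv
    obtain ⟨B, rfl⟩ := hval j w hw
    exact (scale_coarsen A W hvW _ _ hζ (hz i) (h i _ hv)).symm.trans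
      (scale_coarsen B W hwW _ _ hζ (hz j) (h j _ hw))
  · intro hcomp
    obtain ⟨f, hd, hf⟩ := hU
    have good : ∀ i, ∀ v ∈ S i, ∃ A : ValuationSubring K, v = A ∧ Good t f A := by
      intro i v hv
      obtain ⟨A, rfl⟩ := hval i v hv
      obtain ⟨h1, h2, h3, h4⟩ := hf _ (Set.mem_iUnion.2 ⟨i, hv⟩)
      exact ⟨A, rfl, good_of t ht f A h1 h2 h3 h4⟩
    have main : ∀ I : Finset (Fin n), ∃ ζ : K, ζ ≠ 0 ∧
        ∀ i ∈ I, ∀ v ∈ S i, scale ζ v = scale (z i) v := by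
      intro I
      induction I using Finset.induction_on with
      | empty => exact ⟨1, one_ne_zero, by simp⟩
      | insert j I hj ih =>
        obtain ⟨ζ, hζ, hI⟩ := ih
        have hne : ∀ i ∈ I, i ≠ j := fun i hi h => hj (h ▸ hi)
        obtain ⟨y, hy, hy1, hy2⟩ := two_sets t ht f hd (⋃ i ∈ I, S i) (S j)
          (by
            intro v hv
            simp only [Set.mem_iUnion] at hv
            obtain ⟨i, hi, hv⟩ := hv
            exact good i v hv)
          (good j)
          (by
            letI := zarStarTop K
            exact I.isCompact_biUnion fun i _ => hT i)
          (hT j)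
          (by
            intro v hv w hw
            simp only [Set.mem_iUnion] at hv
            obtain ⟨i, hi, hv⟩ := hv
            exact hti i j (hne i hi) v hv w hw)
          (by
            intro v hv w hw
            simp only [Set.mem_iUnion] at hv
            obtain ⟨i, hi, hv⟩ := hv
            exact hinc i j (hne i hi) v hv w hw)
          (z j / ζ) (div_ne_zero (hz j) hζ)
          (by
            rintro W ⟨v, hv, hvW⟩ hw
            simp only [Set.mem_iUnion] at hv
            obtain ⟨i, hi, hv⟩ := hv
            obtain ⟨A, rfl⟩ := hval i v hv
            rw [← val_eq_iff _ _ _ (hz j) hζ, ← scale_eq_iff _ _ _ (hz j) hζ]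
            rw [scale_coarsen A W hvW _ _ hζ (hz i) (hI i hi _ hv)]
            exact (hcomp i j W ⟨W, rfl⟩ ⟨_, hv, hvW⟩ hw).symm)
        refine ⟨ζ * y, mul_ne_zero hζ hy, ?_⟩
        intro i hi v hv
        obtain ⟨A, rfl⟩ := hval i v hv
        rw [scale_eq_iff _ _ _ (mul_ne_zero hζ hy) (hz i), map_mul]
        rcases Finset.mem_insert.1 hi with rfl | hi
        · rw [hy2 A hv, ← map_mul, mul_div_cancel₀ _ hζ]
        · rw [hy1 A (by simp only [Set.mem_iUnion]; exact ⟨i, hi, hv⟩), mul_one]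
          exact (scale_eq_iff _ _ _ hζ (hz i)).1 (hI i hi _ hv)
    obtain ⟨ζ, hζ, h⟩ := main Finset.univ
    exact ⟨ζ, hζ, fun i => h i (Finset.mem_univ i)⟩

end PaperApprox
end

section
/- Let K be a field, π ∈ K^× and e ≥ 1. Let S_1, …, S_n ⊆ S_π^e(K) be pairwise disjoint subsets, each closed in the constructible topology restricted to S_π^e(K). Let x_1, …, x_n ∈ K and z_1, …, z_n ∈ K^× be such that for any valuation ring O_w of K containing a member of S_i and a member of S_j we have x_i − x_j ∈ z_i·O_w and z_i·O_w = z_j·O_w. Then there exists x ∈ K with (x − x_i)/z_i ∈ m_v for all v ∈ S_i, for i = 1, …, n. -/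
namespace PaperApprox

variable {K : Type*} [Field K]

/-! ### Proof of the approximation theorem -/

/-- The working form of membership in `S_π^e`. -/
def PvGood (π : K) (e : ℕ) (v : ValuationSubring K) : Prop :=
  v.valuation π < 1 ∧ ∀ x, v.valuation x < 1 → v.valuation x ^ e ≤ v.valuation π

/-- The holomorphy ring of a set of valuation rings. -/
def holRing (T : Set (ValuationSubring K)) : Subring K where
  carrier := {x | ∀ v ∈ T, x ∈ v}
  mul_mem' ha hb v hv := mul_mem (ha v hv) (hb v hv)
  one_mem' v _ := one_mem v
  add_mem' ha hb v hv := add_mem (ha v hv) (hb v hv)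
  zero_mem' v _ := zero_mem v
  neg_mem' ha v hv := neg_mem (ha v hv)

theorem mem_holRing {T : Set (ValuationSubring K)} {x : K} :
    x ∈ holRing T ↔ ∀ v ∈ T, v.valuation x ≤ 1 :=
  forall₂_congr fun v _ => (v.valuation_le_one_iff x).symm

/-- Finite subcover property. -/
def CpGood (T : Set (ValuationSubring K)) : Prop :=
  ∀ I : Set K, (∀ v ∈ T, ∃ a ∈ I, 1 ≤ v.valuation a) →
    ∃ F : Finset K, (F : Set K) ⊆ I ∧ ∀ v ∈ T, ∃ a ∈ F, 1 ≤ v.valuation a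

theorem key_D {π : K} (hπ : π ≠ 0) {e : ℕ} {v : ValuationSubring K} (hv : PvGood π e v) (x : K) :
    (v.valuation x < 1 → v.valuation (π - x ^ (e + 1)) = v.valuation π) ∧
    (1 ≤ v.valuation x → v.valuation (π - x ^ (e + 1)) = v.valuation x ^ (e + 1)) := by
  have h0 : 0 < v.valuation π := by
    rw [Valuation.pos_iff]; exact hπ
  constructor
  · intro hx
    apply Valuation.map_sub_eq_of_lt_left
    rw [map_pow, pow_succ]
    calc v.valuation x ^ e * v.valuation x ≤ v.valuation π * v.valuation x := by
            gcongr; exact hv.2 x hx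
      _ < v.valuation π * 1 := by gcongr
      _ = _ := mul_one _
  · intro hx
    rw [← map_pow]
    apply Valuation.map_sub_eq_of_lt_right
    rw [map_pow]
    exact hv.1.trans_le (one_le_pow₀ hx)

theorem key_ne {π : K} (hπ : π ≠ 0) {e : ℕ} {v : ValuationSubring K} (hv : PvGood π e v) (x : K) :
    π - x ^ (e + 1) ≠ 0 := by
  rw [← v.valuation.ne_zero_iff]
  rcases lt_or_ge (v.valuation x) 1 with h | h
  · rw [(key_D hπ hv x).1 h]; simpa using hπ
  · rw [(key_D hπ hv x).2 h]
    exact (pow_pos (zero_lt_one.trans_le h) _).ne'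

theorem key_vals {π : K} (hπ : π ≠ 0) {e : ℕ} {v : ValuationSubring K}
    (hv : PvGood π e v) (x : K) :
    v.valuation (π / (π - x ^ (e + 1))) ≤ 1 ∧
    v.valuation (π / (π - x ^ (e + 1)) * x) ≤ 1 ∧
    v.valuation (x ^ e / (π - x ^ (e + 1))) ≤ 1 ∧
    (1 ≤ v.valuation x → v.valuation (π / (π - x ^ (e + 1))) < 1) := by
  have h0 : 0 < v.valuation π := by
    rw [Valuation.pos_iff]; exact hπ
  rcases lt_or_ge (v.valuation x) 1 with h | h
  · have hD := (key_D hπ hv x).1 h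
    have h1 : v.valuation (π / (π - x ^ (e + 1))) = 1 := by
      rw [map_div₀, hD, div_self h0.ne']
    refine ⟨h1.le, ?_, ?_, fun h' => absurd h (not_lt.2 h')⟩
    · rw [map_mul, h1, one_mul]; exact h.le
    · rw [map_div₀, hD, map_pow, div_le_one₀ h0]; exact hv.2 x h
  · have hD := (key_D hπ hv x).2 h
    have hx0 : 0 < v.valuation x := zero_lt_one.trans_le h
    have h1 : v.valuation (π / (π - x ^ (e + 1))) < 1 := by
      rw [map_div₀, hD, div_lt_one₀ (pow_pos hx0 _)]
      exact hv.1.trans_le (one_le_pow₀ h)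
    refine ⟨h1.le, ?_, ?_, fun _ => h1⟩
    · rw [map_mul, map_div₀, hD, div_mul_eq_mul_div, div_le_one₀ (pow_pos hx0 _), pow_succ]
      gcongr
      exact hv.1.le.trans (one_le_pow₀ h)
    · rw [map_div₀, hD, map_pow, div_le_one₀ (pow_pos hx0 _)]
      exact pow_le_pow_right₀ h (Nat.le_succ e)

/-- The Prüfer property of the holomorphy ring. -/
theorem prufer {π : K} (hπ : π ≠ 0) {e : ℕ} {T : Set (ValuationSubring K)}
    (hT : ∀ v ∈ T, PvGood π e v) (hne : T.Nonempty) (x : K) :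
    ∃ s ∈ holRing T, ∃ r ∈ holRing T, s * x ∈ holRing T ∧ 1 - s = r * x ∧
      ∀ v ∈ T, 1 ≤ v.valuation x → v.valuation s < 1 := by
  obtain ⟨v0, hv0⟩ := hne
  have hD := key_ne hπ (hT v0 hv0) x
  refine ⟨π / (π - x ^ (e + 1)), ?_, -(x ^ e / (π - x ^ (e + 1))), ?_, ?_, ?_, ?_⟩
  · exact mem_holRing.2 fun v hv => (key_vals hπ (hT v hv) x).1
  · exact neg_mem (mem_holRing.2 fun v hv => (key_vals hπ (hT v hv) x).2.2.1)
  · exact mem_holRing.2 fun v hv => (key_vals hπ (hT v hv) x).2.1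
  · field_simp; ring
  · exact fun v hv => (key_vals hπ (hT v hv) x).2.2.2

theorem vmul_lt_one {Γ : Type*} [LinearOrderedCommGroupWithZero Γ] {a b : Γ} (ha : a ≤ 1)
    (hb : b < 1) : a * b < 1 :=
  (mul_le_of_le_one_left' ha).trans_lt hb

theorem val_eq_one_of_sub {v : ValuationSubring K} {u : K} (h : v.valuation (1 - u) < 1) :
    v.valuation u = 1 := by
  have := Valuation.map_sub_eq_of_lt_right v.valuation (x := 1 - u) (y := 1) (by simpa using h)
  rw [map_one] at this
  rw [← this, ← Valuation.map_neg]
  congr 1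
  ring

/-- Local-global principle. -/
theorem local_global {π : K} (hπ : π ≠ 0) {e : ℕ} {T : Set (ValuationSubring K)}
    (hT : ∀ v ∈ T, PvGood π e v) (hne : T.Nonempty) (hC : CpGood T)
    (I : AddSubgroup K) (hI : ∀ r ∈ holRing T, ∀ a ∈ I, r * a ∈ I)
    (hloc : ∀ v ∈ T, ∃ a ∈ I, a ∈ holRing T ∧ 1 ≤ v.valuation a) : (1 : K) ∈ I := by
  classical
  obtain ⟨F, hF, hcov⟩ := hC {a | a ∈ I ∧ a ∈ holRing T} (by
    intro v hv
    obtain ⟨a, h1, h2, h3⟩ := hloc v hv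
    exact ⟨a, ⟨h1, h2⟩, h3⟩)
  have comb : ∀ F : Finset K, (F : Set K) ⊆ {a | a ∈ I ∧ a ∈ holRing T} →
      ∃ u ∈ I, u ∈ holRing T ∧ ∀ v ∈ T, (∃ a ∈ F, 1 ≤ v.valuation a) →
        v.valuation (1 - u) < 1 := by
    intro F
    induction F using Finset.induction_on with
    | empty => exact fun _ => ⟨0, zero_mem _, zero_mem _, by simp⟩
    | insert a F _ ih =>
      intro hF
      rw [Finset.coe_insert, Set.insert_subset_iff] at hF
      obtain ⟨⟨haI, haR⟩, hF⟩ := hF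
      obtain ⟨u, huI, huR, hu⟩ := ih hF
      obtain ⟨s, hs, r, hr, -, hsr, hlt⟩ := prufer hπ hT hne a
      have h1 : r * a ∈ I := hI r hr a haI
      have h1R : r * a ∈ holRing T := mul_mem hr haR
      refine ⟨u + s * 0 + (1 - u) * (r * a), ?_, ?_, ?_⟩
      · rw [mul_zero, add_zero]
        exact add_mem huI (hI _ (sub_mem (one_mem _) huR) _ h1)
      · rw [mul_zero, add_zero]
        exact add_mem huR (mul_mem (sub_mem (one_mem _) huR) h1R)
      · intro v hv hex
        have heq : 1 - (u + s * 0 + (1 - u) * (r * a)) = (1 - u) * s := by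
          rw [← hsr]; ring
        have hs1 : v.valuation s ≤ 1 := mem_holRing.1 hs v hv
        have hu1 : v.valuation (1 - u) ≤ 1 := mem_holRing.1 (sub_mem (one_mem _) huR) v hv
        rw [heq, map_mul]
        obtain ⟨b, hb, hb1⟩ := hex
        rcases Finset.mem_insert.1 hb with rfl | hb
        · exact vmul_lt_one hu1 (hlt v hv hb1)
        · rw [mul_comm]; exact vmul_lt_one hs1 (hu v hv ⟨b, hb, hb1⟩)
  obtain ⟨u, huI, huR, hu⟩ := comb F hF
  have hu1 : ∀ v ∈ T, v.valuation u = 1 := fun v hv => val_eq_one_of_sub (hu v hv (hcov v hv))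
  have hu0 : u ≠ 0 := by
    obtain ⟨v, hv⟩ := hne
    rintro rfl
    have := hu1 v hv
    simp at this
  have : u⁻¹ * u ∈ I := hI _ (mem_holRing.2 fun v hv => by simp [hu1 v hv]) _ huI
  rwa [inv_mul_cancel₀ hu0] at this

/-- Elements of `O_v` are fractions. -/
theorem frac {π : K} (hπ : π ≠ 0) {e : ℕ} {T : Set (ValuationSubring K)}
    (hT : ∀ v ∈ T, PvGood π e v) {v : ValuationSubring K} (hv : v ∈ T) {y : K} (hy : y ∈ v) :
    ∃ s ∈ holRing T, v.valuation s = 1 ∧ s * y ∈ holRing T := by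
  obtain ⟨s, hs, r, hr, hsx, hsr, -⟩ := prufer hπ hT ⟨v, hv⟩ y
  have hs1 : v.valuation s ≤ 1 := mem_holRing.1 hs v hv
  have hr1 : v.valuation r ≤ 1 := mem_holRing.1 hr v hv
  have hy1 := (v.valuation_le_one_iff y).2 hy
  rcases hs1.eq_or_lt with h | h
  · exact ⟨s, hs, h, hsx⟩
  · refine ⟨r, hr, ?_, hsr ▸ sub_mem (one_mem _) hs⟩
    have : v.valuation (r * y) = 1 := by
      rw [← hsr]; exact val_eq_one_of_sub (by simpa using h)
    rw [map_mul] at this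
    refine le_antisymm hr1 ?_
    rw [← this]
    exact mul_le_of_le_one_right' hy1

/-- A valuation overring of the holomorphy ring coarsens a member. -/
theorem overring {π : K} (hπ : π ≠ 0) {e : ℕ} {T : Set (ValuationSubring K)}
    (hT : ∀ v ∈ T, PvGood π e v) (hne : T.Nonempty) (hC : CpGood T)
    (W : ValuationSubring K) (hW : ∀ x ∈ holRing T, x ∈ W) : ∃ v ∈ T, v ≤ W := by
  by_contra hcon
  push Not at hcon
  let I : AddSubgroup K :=
    { carrier := {a | W.valuation a < 1}
      add_mem' := fun {a b} ha hb => W.valuation.map_add_lt (x := a) (y := b) ha hb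
      zero_mem' := by simp
      neg_mem' := fun {a} ha => by simpa using ha }
  have h1 : (1 : K) ∈ I := by
    apply local_global hπ hT hne hC I
    · intro r hr a ha
      change W.valuation (r * a) < 1
      rw [map_mul]
      exact vmul_lt_one ((W.valuation_le_one_iff r).2 (hW r hr)) ha
    · intro v hv
      obtain ⟨y, hyv, hyW⟩ := SetLike.not_le_iff_exists.1 (hcon v hv)
      obtain ⟨s, hs, hs1, hsy⟩ := frac hπ hT hv hyv
      refine ⟨s, ?_, hs, hs1.ge⟩
      change W.valuation s < 1
      by_contra h
      have hs' : W.valuation s = 1 :=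
        le_antisymm ((W.valuation_le_one_iff s).2 (hW s hs)) (not_lt.1 h)
      apply hyW
      rw [← W.valuation_le_one_iff]
      have := (W.valuation_le_one_iff _).2 (hW _ hsy)
      rwa [map_mul, hs', one_mul] at this
  change W.valuation 1 < 1 at h1
  simp at h1

/-- The localization of `holRing T` at `v`. -/
def locRing {S T : Set (ValuationSubring K)} (hTS : T ⊆ S) (v : ValuationSubring K)
    (hfr : ∀ y ∈ v, ∃ s ∈ holRing S, v.valuation s = 1 ∧ s * y ∈ holRing S) :
    ValuationSubring K where
  carrier := {y | ∃ s ∈ holRing S, v.valuation s = 1 ∧ s * y ∈ holRing T}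
  mul_mem' := by
    rintro a b ⟨s, hs, h1, h2⟩ ⟨s', hs', h1', h2'⟩
    refine ⟨s * s', mul_mem hs hs', by simp [h1, h1'], ?_⟩
    rw [mul_mul_mul_comm]; exact mul_mem h2 h2'
  one_mem' := ⟨1, one_mem _, by simp, by simpa using one_mem _⟩
  add_mem' := by
    rintro a b ⟨s, hs, h1, h2⟩ ⟨s', hs', h1', h2'⟩
    refine ⟨s * s', mul_mem hs hs', by simp [h1, h1'], ?_⟩
    have e1 : s * s' * (a + b) = s' * (s * a) + s * (s' * b) := by ring
    rw [e1]
    exact add_mem (mul_mem (fun v hv => hs' v (hTS hv)) h2)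
      (mul_mem (fun v hv => hs v (hTS hv)) h2')
  zero_mem' := ⟨1, one_mem _, by simp, by simpa using zero_mem _⟩
  neg_mem' := by
    rintro a ⟨s, hs, h1, h2⟩
    exact ⟨s, hs, h1, by rw [mul_neg]; exact neg_mem h2⟩
  mem_or_inv_mem' := by
    intro y
    rcases v.mem_or_inv_mem y with h | h
    · left
      obtain ⟨s, hs, h1, h2⟩ := hfr _ h
      exact ⟨s, hs, h1, fun v hv => h2 v (hTS hv)⟩
    · right
      obtain ⟨s, hs, h1, h2⟩ := hfr _ h
      exact ⟨s, hs, h1, fun v hv => h2 v (hTS hv)⟩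

theorem eq_of_coarsen {π : K} {e : ℕ} {v W : ValuationSubring K}
    (hv : PvGood π e v) (hπ : π ≠ 0) (hle : v ≤ W) (hW : π⁻¹ ∉ W) : v = W := by
  refine le_antisymm hle fun y hy => ?_
  by_contra hyv
  apply hW
  have h1 : v.valuation y⁻¹ < 1 := by
    rw [map_inv₀]
    apply inv_lt_one_of_one_lt₀
    rw [← not_le, v.valuation_le_one_iff]; exact hyv
  have h2 := hv.2 _ h1
  have h3 : (y⁻¹) ^ e * π⁻¹ ∈ v := by
    rw [← v.valuation_le_one_iff, map_mul, map_pow, map_inv₀ _ π, ← div_eq_mul_inv,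
      div_le_one₀ ((Valuation.pos_iff _).2 hπ)]
    exact h2
  have hy0 : y ≠ 0 := by rintro rfl; exact hyv (zero_mem _)
  have h4 : y ^ e * ((y⁻¹) ^ e * π⁻¹) ∈ W := mul_mem (pow_mem hy e) (hle h3)
  rwa [← mul_assoc, ← mul_pow, mul_inv_cancel₀ hy0, one_pow, one_mul] at h4

theorem local_step {π : K} (hπ : π ≠ 0) {e : ℕ} {S T : Set (ValuationSubring K)}
    (hS : ∀ v ∈ S, PvGood π e v) (hTS : T ⊆ S) (hne : T.Nonempty) (hC : CpGood T)
    {v : ValuationSubring K} (hv : v ∈ S) (hvT : v ∉ T) :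
    ∃ W : ValuationSubring K, v ≤ W ∧ (∃ v' ∈ T, v' ≤ W) ∧
      ∀ y ∈ W, ∃ s ∈ holRing S, v.valuation s = 1 ∧
        ∀ v' ∈ T, v'.valuation (s * y) ≤ v'.valuation π := by
  have hfr : ∀ y ∈ v, ∃ s ∈ holRing S, v.valuation s = 1 ∧ s * y ∈ holRing S :=
    fun y hy => frac hπ hS hv hy
  have hT : ∀ v ∈ T, PvGood π e v := fun v hv => hS v (hTS hv)
  let W := locRing hTS v hfr
  have hvW : v ≤ W := by
    intro y hy
    obtain ⟨s, hs, h1, h2⟩ := hfr y hy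
    exact ⟨s, hs, h1, fun v hv => h2 v (hTS hv)⟩
  obtain ⟨v', hv', hv'W⟩ := overring hπ hT hne hC W
    (fun x hx => ⟨1, one_mem _, by simp, by simpa using hx⟩)
  refine ⟨W, hvW, ⟨v', hv', hv'W⟩, ?_⟩
  have hπW : π⁻¹ ∈ W := by
    by_contra h
    have h1 := eq_of_coarsen (hS v hv) hπ hvW h
    have h2 := eq_of_coarsen (hT v' hv') hπ hv'W h
    exact hvT (by rw [h1, ← h2]; exact hv')
  intro y hy
  obtain ⟨s, hs, h1, h2⟩ := W.mul_mem _ _ hπW hy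
  refine ⟨s, hs, h1, fun v'' hv'' => ?_⟩
  have h3 := mem_holRing.1 h2 v'' hv''
  have h4 : s * y = s * (π⁻¹ * y) * π := by field_simp
  rw [h4, map_mul]
  exact mul_le_of_le_one_left' h3

/-- Distributivity of submodules over a Prüfer domain, elementwise. -/
theorem distrib_step {R : Subring K}
    (hR : ∀ x : K, ∃ s ∈ R, ∃ r ∈ R, s * x ∈ R ∧ 1 - s = r * x)
    (M N P : AddSubgroup K) (hM : ∀ r ∈ R, ∀ a ∈ M, r * a ∈ M) (hN : ∀ r ∈ R, ∀ a ∈ N, r * a ∈ N)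
    (hP : ∀ r ∈ R, ∀ a ∈ P, r * a ∈ P) {c : K} (h1 : c ∈ M ⊔ N) (h2 : c ∈ M ⊔ P) :
    c ∈ M ⊔ (N ⊓ P) := by
  obtain ⟨a, ha, b, hb, hab⟩ := AddSubgroup.mem_sup.1 h1
  obtain ⟨a', ha', b', hb', hab'⟩ := AddSubgroup.mem_sup.1 h2
  by_cases hb0 : b' = 0
  · refine AddSubgroup.mem_sup.2 ⟨a', ha', 0, zero_mem _, ?_⟩
    rw [← hab', hb0]
  obtain ⟨s, hs, r, hr, hsx, hsr⟩ := hR (b / b')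
  have h1s : 1 - s ∈ R := sub_mem (one_mem _) hs
  have e1 : s * b = (s * (b / b')) * b' := by field_simp
  have e2 : (1 - s) * b' = r * b := by rw [hsr]; field_simp
  refine AddSubgroup.mem_sup.2 ⟨s * a + (1 - s) * a', add_mem (hM _ hs _ ha) (hM _ h1s _ ha'),
    s * b + (1 - s) * b', add_mem ⟨hN _ hs _ hb, ?_⟩ ⟨?_, hP _ h1s _ hb'⟩, ?_⟩
  · rw [e1]; exact hP _ hsx _ hb'
  · rw [e2]; exact hN _ hr _ hb
  · linear_combination s * hab + (1 - s) * hab'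

theorem crt {ι : Type*} {R : Subring K}
    (hR : ∀ x : K, ∃ s ∈ R, ∃ r ∈ R, s * x ∈ R ∧ 1 - s = r * x)
    (M : ι → AddSubgroup K) (hM : ∀ i, ∀ r ∈ R, ∀ a ∈ M i, r * a ∈ M i) (x : ι → K)
    (hx : ∀ i j, x i - x j ∈ M i ⊔ M j) (s : Finset ι) :
    ∃ a, ∀ i ∈ s, a - x i ∈ M i := by
  classical
  have dist : ∀ (k : ι) (c : K) (s : Finset ι), (∀ i ∈ s, c ∈ M k ⊔ M i) →
      ∃ N : AddSubgroup K, (∀ r ∈ R, ∀ a ∈ N, r * a ∈ N) ∧ (∀ i ∈ s, N ≤ M i) ∧ c ∈ M k ⊔ N := by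
    intro k c s
    induction s using Finset.induction_on with
    | empty => exact fun _ => ⟨⊤, by simp, by simp, by simp⟩
    | insert i s _ ih =>
      intro h
      obtain ⟨N, h1, h2, h3⟩ := ih fun i hi => h i (Finset.mem_insert_of_mem hi)
      refine ⟨M i ⊓ N, fun r hr a ha => ⟨hM i r hr a ha.1, h1 r hr a ha.2⟩, ?_, ?_⟩
      · intro j hj
        rcases Finset.mem_insert.1 hj with rfl | hj
        · exact inf_le_left
        · exact inf_le_right.trans (h2 j hj)
      · exact distrib_step hR _ _ _ (hM k) (hM i) h1 (h i (Finset.mem_insert_self _ _)) h3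
  induction s using Finset.induction_on with
  | empty => exact ⟨0, by simp⟩
  | insert k s _ ih =>
    obtain ⟨y, hy⟩ := ih
    obtain ⟨N, -, h2, h3⟩ := dist k (y - x k) s (by
      intro i hi
      have : y - x k = (y - x i) - (x k - x i) := by ring
      rw [this]
      exact sub_mem (AddSubgroup.mem_sup_right (hy i hi)) (hx k i))
    obtain ⟨a, ha, b, hb, hab⟩ := AddSubgroup.mem_sup.1 h3
    refine ⟨y - b, fun i hi => ?_⟩
    rcases Finset.mem_insert.1 hi with rfl | hi
    · have : y - b - x i = a := by linear_combination -hab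
      rwa [this]
    · have : y - b - x i = (y - x i) - b := by ring
      rw [this]
      exact sub_mem (hy i hi) (h2 i hi hb)

theorem mem_mball_iff (v : ValuationSubring K) (x : K) :
    x ∈ mball (v : Set K) ↔ v.valuation x < 1 := by
  by_cases hx : x = 0
  · subst hx; simp [mball, zero_mem]
  · have h0 : 0 < v.valuation x := (Valuation.pos_iff _).2 hx
    have h1 : x⁻¹ ∈ v ↔ 1 ≤ v.valuation x := by
      rw [← v.valuation_le_one_iff, map_inv₀, inv_le_one₀ h0]
    simp only [mball, Set.mem_diff, Set.mem_inter_iff, SetLike.mem_coe, Set.mem_setOf_eq, h1,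
      ← v.valuation_le_one_iff x]
    constructor
    · rintro ⟨h2, h3⟩
      by_contra h4
      exact h3 ⟨h2, hx, not_lt.1 h4⟩
    · exact fun h => ⟨h.le, fun h' => absurd h (not_lt.2 h'.2.2)⟩

theorem good_of_SPiE {π : K} (hπ : π ≠ 0) {e : ℕ} (he : 1 ≤ e) {v : ValuationSubring K}
    (h : (v : Set K) ∈ SPiE π e) : PvGood π e v := by
  obtain ⟨A, hA, γ, h0, h1, hmax, -, hπ1, hγ⟩ := h
  obtain rfl : v = A := SetLike.coe_injective hA
  refine ⟨hπ1, fun x hx => ?_⟩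
  by_cases hx0 : v.valuation x = 0
  · rw [hx0, zero_pow (by omega)]; exact zero_le'
  · exact (pow_le_pow_left₀ zero_le' (hmax _ hx0 hx) e).trans hγ

theorem SPiE_of_good {π : K} (hπ : π ≠ 0) {e : ℕ} {v : ValuationSubring K}
    (h : PvGood π e v) : (v : Set K) ∈ SPiE π e := by
  classical
  obtain ⟨hπ1, hP⟩ := h
  have hπ0 : 0 < v.valuation π := (Valuation.pos_iff _).2 hπ
  have hP' : ∀ δ : v.ValueGroup, δ < 1 → δ ^ e ≤ v.valuation π := by
    intro δ hδ
    obtain ⟨x, rfl⟩ := v.valuation_surjective δ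
    exact hP x hδ
  let Q : ℕ → Prop := fun k => ∃ δ : v.ValueGroup, δ < 1 ∧ v.valuation π ≤ δ ^ k
  have hQ1 : Q 1 := ⟨_, hπ1, by simp⟩
  have hQb : ∀ k, Q k → k ≤ e := by
    rintro k ⟨δ, hδ, hk⟩
    by_contra hlt
    have hδ0 : 0 < δ := by
      rcases eq_or_ne δ 0 with rfl | hne
      · rw [zero_pow (by omega)] at hk; exact absurd hπ0 (not_lt.2 hk)
      · exact zero_lt_iff.2 hne
    have h1 : δ ^ k < δ ^ e := pow_lt_pow_right_of_lt_one₀ hδ0 hδ (by omega)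
    exact absurd (hk.trans_lt h1) (not_lt.2 (hP' δ hδ))
  have he1 := hQb 1 hQ1
  set k := Nat.findGreatest Q e with hk
  have hQk : Q k := Nat.findGreatest_spec he1 hQ1
  have hk1 : 1 ≤ k := Nat.le_findGreatest he1 hQ1
  obtain ⟨γ, hγ1, hγk⟩ := hQk
  have hγ0 : γ ≠ 0 := by
    rintro rfl
    rw [zero_pow (by omega)] at hγk; exact absurd hπ0 (not_lt.2 hγk)
  have hγ0' : 0 < γ := zero_lt_iff.2 hγ0
  have hmax : ∀ δ : v.ValueGroup, δ < 1 → δ ≤ γ := by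
    intro δ hδ
    by_contra hlt
    rw [not_le] at hlt
    have hδ0 : 0 < δ := hγ0'.trans hlt
    have hρ : γ / δ < 1 := (div_lt_one₀ hδ0).2 hlt
    have hτ : max (γ / δ) δ < 1 := max_lt hρ hδ
    have h2 : γ ≤ max (γ / δ) δ ^ 2 := by
      calc γ = (γ / δ) * δ := (div_mul_cancel₀ _ hδ0.ne').symm
        _ ≤ max (γ / δ) δ * max (γ / δ) δ := by
          gcongr
          · exact le_max_left _ _
          · exact le_max_right _ _
        _ = _ := (sq _).symm
    have hQ2 : Q (2 * k) := ⟨_, hτ, by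
      rw [pow_mul]; exact hγk.trans (pow_le_pow_left₀ zero_le' h2 k)⟩
    have := Nat.le_findGreatest (hQb _ hQ2) hQ2
    omega
  refine ⟨v, rfl, γ, hγ0, hγ1, fun δ _ h => hmax δ h, ?_, hπ1, hP' γ hγ1⟩
  intro δ hδ m n hm hn
  obtain ⟨j, hj, hjmax⟩ := Int.exists_greatest_of_bdd (P := fun j : ℤ => δ ≤ γ ^ j)
    ⟨m, fun j hj => by
      by_contra hlt
      have : γ ^ j < γ ^ m := zpow_lt_zpow_right_of_lt_one₀ hγ0' hγ1 (not_le.1 hlt)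
      exact absurd (hm.trans hj) (not_le.2 this)⟩ ⟨n, hn⟩
  refine ⟨j, le_antisymm hj ?_⟩
  by_contra hlt
  rw [not_le] at hlt
  have hpos : 0 < γ ^ j := zpow_pos hγ0' j
  have h1 := hmax (δ / γ ^ j) ((div_lt_one₀ hpos).2 hlt)
  have h2 := hjmax (j + 1) (by
    rw [div_le_iff₀ hpos] at h1
    rw [zpow_add_one₀ hγ0, mul_comm]
    exact h1)
  omega

/-- The ultrafilter limit of valuation rings. -/
def ultraLim (F : Ultrafilter (Set K))
    (hF : ∀ᶠ O in (F : Filter (Set K)), IsValuationLocality O) : ValuationSubring K where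
  carrier := {x | ∀ᶠ O in (F : Filter (Set K)), x ∈ O}
  mul_mem' := by
    intro a b ha hb
    filter_upwards [hF, ha, hb]
    rintro O ⟨A, rfl⟩ h1 h2
    exact mul_mem (S := ValuationSubring K) h1 h2
  one_mem' := by
    filter_upwards [hF]
    rintro O ⟨A, rfl⟩
    exact one_mem A
  add_mem' := by
    intro a b ha hb
    filter_upwards [hF, ha, hb]
    rintro O ⟨A, rfl⟩ h1 h2
    exact add_mem (S := ValuationSubring K) h1 h2
  zero_mem' := by
    filter_upwards [hF]
    rintro O ⟨A, rfl⟩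
    exact zero_mem A
  neg_mem' := by
    intro a ha
    filter_upwards [hF, ha]
    rintro O ⟨A, rfl⟩ h1
    exact neg_mem (S := ValuationSubring K) h1
  mem_or_inv_mem' := by
    intro x
    refine Ultrafilter.eventually_or.1 ?_
    filter_upwards [hF]
    rintro O ⟨A, rfl⟩
    exact A.mem_or_inv_mem x

theorem compact_of_closed {π : K} (hπ : π ≠ 0) {e : ℕ} (he : 1 ≤ e) {C : Set (Set K)}
    (hC : @IsClosed (Set K) (conTop K) C) : @IsCompact (Set K) (conTop K) (C ∩ SPiE π e) := by
  letI := conTop K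
  rw [isCompact_iff_ultrafilter_le_nhds']
  intro F hF
  have hFC : C ∈ F := Filter.mem_of_superset hF Set.inter_subset_left
  have hFS : ∀ᶠ O in (F : Filter (Set K)), O ∈ SPiE π e :=
    Filter.mem_of_superset hF Set.inter_subset_right
  have hFv : ∀ᶠ O in (F : Filter (Set K)), IsValuationLocality O := by
    filter_upwards [hFS]
    rintro O ⟨A, hA, -⟩
    exact ⟨A, hA⟩
  let v := ultraLim F hFv
  have hmem : ∀ x, x ∈ v ↔ ∀ᶠ O in (F : Filter (Set K)), x ∈ O := fun x => Iff.rfl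
  have hmb : ∀ x, x ∈ mball (v : Set K) ↔ ∀ᶠ O in (F : Filter (Set K)), x ∈ mball O := by
    intro x
    simp only [mball, Set.mem_diff, Set.mem_inter_iff, SetLike.mem_coe, Set.mem_setOf_eq, hmem]
    rw [Filter.eventually_and, Ultrafilter.eventually_not, Filter.eventually_and,
      Filter.eventually_and, Filter.eventually_const]
  have hgood : PvGood π e v := by
    have key : ∀ᶠ O in (F : Filter (Set K)), ∃ A : ValuationSubring K, (O : Set K) = (A : Set K) ∧ PvGood π e A := by
      filter_upwards [hFS]
      intro O hO
      obtain ⟨A, hA, -⟩ := id hO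
      exact ⟨A, hA, good_of_SPiE hπ he (hA ▸ hO)⟩
    constructor
    · rw [← mem_mball_iff, hmb]
      filter_upwards [key]
      rintro O ⟨A, rfl, hA⟩
      exact (mem_mball_iff _ _).2 hA.1
    · intro x hx
      rw [← mem_mball_iff, hmb] at hx
      rw [← map_pow, ← div_le_one₀ ((Valuation.pos_iff _).2 hπ), ← map_div₀,
        v.valuation_le_one_iff, hmem]
      filter_upwards [key, hx]
      rintro O ⟨A, rfl, hA⟩ hx
      rw [mem_mball_iff] at hx
      have := hA.2 x hx
      rwa [← map_pow, ← div_le_one₀ ((Valuation.pos_iff _).2 hπ), ← map_div₀,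
        A.valuation_le_one_iff] at this
  have hle : (F : Filter (Set K)) ≤ nhds (v : Set K) := by
    refine le_of_le_of_eq ?_ (TopologicalSpace.nhds_generateFrom (a := (v : Set K))).symm
    refine le_iInf₂ ?_
    rintro U ⟨hvU, ⟨x, rfl⟩ | ⟨x, rfl⟩⟩
    · exact Filter.le_principal_iff.2 ((hmem x).1 hvU)
    · exact Filter.le_principal_iff.2 ((hmb x).1 hvU)
  exact ⟨v, ⟨hC.mem_of_tendsto (b := (F : Filter (Set K))) (f := id) hle hFC,
    SPiE_of_good hπ hgood⟩, hle⟩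

theorem cpGood_of_compact {S : Set (Set K)} (hS : @IsCompact (Set K) (conTop K) S) :
    CpGood {v : ValuationSubring K | (v : Set K) ∈ S ∧ S ⊆ {O | IsValuationLocality O}} := by
  classical
  letI := conTop K
  intro I hI
  by_cases hSV : S ⊆ {O | IsValuationLocality O}
  swap
  · exact ⟨∅, by simp, fun v hv => absurd hv.2 hSV⟩
  have hiff : ∀ (v : ValuationSubring K) (a : K), 1 ≤ v.valuation a ↔ a ≠ 0 ∧ a⁻¹ ∈ v := by
    intro v a
    by_cases ha : a = 0
    · simp [ha]
    · rw [← v.valuation_le_one_iff, map_inv₀, inv_le_one₀ ((Valuation.pos_iff _).2 ha)]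
      simp [ha]
  obtain ⟨t, ht⟩ := hS.elim_finite_subcover
    (fun a : {a : K // a ∈ I ∧ a ≠ 0} => {O : Set K | (a : K)⁻¹ ∈ O})
    (fun a => TopologicalSpace.isOpen_generateFrom_of_mem (Or.inl ⟨_, rfl⟩)) (by
      intro O hO
      obtain ⟨v, rfl⟩ := hSV hO
      obtain ⟨a, haI, ha⟩ := hI v ⟨hO, hSV⟩
      rw [hiff] at ha
      exact Set.mem_iUnion.2 ⟨⟨a, haI, ha.1⟩, ha.2⟩)
  refine ⟨t.image Subtype.val, ?_, ?_⟩
  · intro a ha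
    simp only [Finset.coe_image, Set.mem_image] at ha
    obtain ⟨b, -, rfl⟩ := ha
    exact b.2.1
  · intro v hv
    obtain ⟨a, hat, ha⟩ := Set.mem_iUnion₂.1 (ht hv.1)
    exact ⟨a, Finset.mem_image_of_mem _ hat, (hiff v a).2 ⟨a.2.2, ha⟩⟩

/-- The main approximation statement, for sets of valuation subrings. -/
theorem approx_main {π : K} (hπ : π ≠ 0) {e : ℕ} {ι : Type*} [Fintype ι]
    (T : ι → Set (ValuationSubring K)) (hT : ∀ i, ∀ v ∈ T i, PvGood π e v)
    (hC : ∀ i, CpGood (T i)) (hCU : CpGood (⋃ i, T i))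
    (hdisj : ∀ i j, i ≠ j → ∀ v, v ∈ T i → v ∉ T j)
    (x z : ι → K) (hz : ∀ i, z i ≠ 0)
    (hI : ∀ i j, ∀ W : ValuationSubring K, (∃ v ∈ T i, v ≤ W) → (∃ v ∈ T j, v ≤ W) →
      (x i - x j) / z i ∈ W) :
    ∃ a : K, ∀ i, ∀ v ∈ T i, v.valuation (a - x i) < v.valuation (z i) := by
  set S := ⋃ i, T i with hSdef
  have hS : ∀ v ∈ S, PvGood π e v := by
    intro v hv
    obtain ⟨i, hi⟩ := Set.mem_iUnion.1 hv
    exact hT i v hi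
  have hTS : ∀ i, T i ⊆ S := fun i => Set.subset_iUnion T i
  rcases S.eq_empty_or_nonempty with hemp | hSne
  · refine ⟨0, fun i v hv => ?_⟩
    have := hTS i hv
    rw [hemp] at this
    exact absurd this (Set.notMem_empty v)
  let M : ι → AddSubgroup K := fun i =>
    { carrier := {y | ∀ v ∈ T i, v.valuation y < v.valuation (z i)}
      add_mem' := fun ha hb v hv => Valuation.map_add_lt _ (ha v hv) (hb v hv)
      zero_mem' := fun v _ => by
        rw [map_zero]; exact (Valuation.pos_iff _).2 (hz i)
      neg_mem' := fun {a} ha v hv => by simpa using ha v hv }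
  have hM : ∀ i, ∀ r ∈ holRing S, ∀ a ∈ M i, r * a ∈ M i := by
    intro i r hr a ha v hv
    rw [map_mul]
    exact (mul_le_of_le_one_left' (mem_holRing.1 hr v (hTS i hv))).trans_lt (ha v hv)
  -- membership from a local witness
  have wit : ∀ i y s, (∀ v ∈ T i, v.valuation (s * (y / z i)) ≤ v.valuation π) →
      s * y ∈ M i := by
    intro i y s h v hv
    have h1 := (h v hv).trans_lt (hT i v hv).1
    have h2 : s * y = s * (y / z i) * z i := by
      have := hz i
      field_simp
    rw [h2, map_mul]
    exact mul_lt_of_lt_one_left ((Valuation.pos_iff _).2 (hz i)) h1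
  have hpair : ∀ i j, x i - x j ∈ M i ⊔ M j := by
    intro i j
    by_cases hij : i = j
    · subst hij; simp
    rcases (T i).eq_empty_or_nonempty with hi | hine
    · exact AddSubgroup.mem_sup_left (fun v hv => by rw [hi] at hv; exact absurd hv (by simp))
    rcases (T j).eq_empty_or_nonempty with hj | hjne
    · exact AddSubgroup.mem_sup_right (fun v hv => by rw [hj] at hv; exact absurd hv (by simp))
    let I : AddSubgroup K := (M i ⊔ M j).comap (AddMonoidHom.mulRight (x i - x j))
    have hIm : ∀ a, a ∈ I ↔ a * (x i - x j) ∈ M i ⊔ M j := fun a => Iff.rfl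
    have h1 : (1 : K) ∈ I := by
      apply local_global hπ hS hSne hCU I
      · intro r hr a ha
        rw [hIm] at ha ⊢
        obtain ⟨b, hb, c, hc, hbc⟩ := AddSubgroup.mem_sup.1 ha
        exact AddSubgroup.mem_sup.2 ⟨r * b, hM i r hr b hb, r * c, hM j r hr c hc, by
          linear_combination r * hbc⟩
      · intro v hv
        have hswap : ∀ W : ValuationSubring K, (∃ v ∈ T i, v ≤ W) → (∃ v ∈ T j, v ≤ W) →
            (x i - x j) / z j ∈ W := by
          intro W hi hj
          have := neg_mem (hI j i W hj hi)
          rwa [← neg_div, neg_sub] at this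
        have left : ∀ W : ValuationSubring K, (∃ v ∈ T i, v ≤ W) → (∃ v ∈ T j, v ≤ W) →
            (∀ y ∈ W, ∃ s ∈ holRing S, v.valuation s = 1 ∧
              ∀ v' ∈ T i, v'.valuation (s * y) ≤ v'.valuation π) →
            ∃ a ∈ I, a ∈ holRing S ∧ 1 ≤ v.valuation a := by
          intro W hi hj hW
          obtain ⟨s, hs, hs1, h⟩ := hW _ (hI i j W hi hj)
          exact ⟨s, (hIm s).2 (AddSubgroup.mem_sup_left (wit i _ s h)), hs, hs1.ge⟩
        have right : ∀ W : ValuationSubring K, (∃ v ∈ T i, v ≤ W) → (∃ v ∈ T j, v ≤ W) →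
            (∀ y ∈ W, ∃ s ∈ holRing S, v.valuation s = 1 ∧
              ∀ v' ∈ T j, v'.valuation (s * y) ≤ v'.valuation π) →
            ∃ a ∈ I, a ∈ holRing S ∧ 1 ≤ v.valuation a := by
          intro W hi hj hW
          obtain ⟨s, hs, hs1, h⟩ := hW _ (hswap W hi hj)
          exact ⟨s, (hIm s).2 (AddSubgroup.mem_sup_right (wit j _ s h)), hs, hs1.ge⟩
        by_cases hvi : v ∈ T i
        · obtain ⟨W, hvW, hjW, hW⟩ :=
            local_step hπ hS (hTS j) hjne (hC j) hv (hdisj i j hij v hvi)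
          exact right W ⟨v, hvi, hvW⟩ hjW hW
        obtain ⟨W, hvW, hiW, hW⟩ := local_step hπ hS (hTS i) hine (hC i) hv hvi
        by_cases hvj : v ∈ T j
        · exact left W hiW ⟨v, hvj, hvW⟩ hW
        obtain ⟨W', hvW', hjW', hW'⟩ := local_step hπ hS (hTS j) hjne (hC j) hv hvj
        have htot : W ≤ W' ∨ W' ≤ W := by
          by_contra hcon
          push Not at hcon
          obtain ⟨a, haW, haW'⟩ := SetLike.not_le_iff_exists.1 hcon.1
          obtain ⟨b, hbW', hbW⟩ := SetLike.not_le_iff_exists.1 hcon.2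
          have hb0 : b ≠ 0 := by rintro rfl; exact hbW (zero_mem _)
          have ha0 : a ≠ 0 := by rintro rfl; exact haW' (zero_mem _)
          rcases v.mem_or_inv_mem (a / b) with h | h
          · apply haW'
            have := mul_mem (hvW' h) hbW'
            rwa [div_mul_cancel₀ _ hb0] at this
          · apply hbW
            rw [inv_div] at h
            have := mul_mem (hvW h) haW
            rwa [div_mul_cancel₀ _ ha0] at this
        rcases htot with h | h
        · obtain ⟨u, hu, huW⟩ := hiW
          exact right W' ⟨u, hu, huW.trans h⟩ hjW' hW'
        · obtain ⟨u, hu, huW⟩ := hjW'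
          exact left W hiW ⟨u, hu, huW.trans h⟩ hW
    rw [hIm, one_mul] at h1
    exact h1
  obtain ⟨a, ha⟩ := crt (R := holRing S) (fun y => by
    obtain ⟨s, hs, r, hr, h1, h2, -⟩ := prufer hπ hS hSne y
    exact ⟨s, hs, r, hr, h1, h2⟩) M hM x hpair Finset.univ
  exact ⟨a, fun i v hv => ha i (Finset.mem_univ i) v hv⟩

/-- **Corollary 5.5**: approximation on pairwise disjoint constructibly closed subsets of
`S_π^e(K)`. -/
theorem approx_SPiE {K : Type*} [Field K] (π : K) (hπ : π ≠ 0) (e : ℕ) (he : 1 ≤ e)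
    (n : ℕ) (S : Fin n → Set (Set K)) (hsub : ∀ i, S i ⊆ SPiE π e)
    (hdisj : ∀ i j, i ≠ j → ∀ v, v ∈ S i → v ∉ S j)
    (hT : ∀ i, ∃ C : Set (Set K), @IsClosed (Set K) (conTop K) C ∧ S i = C ∩ SPiE π e)
    (x z : Fin n → K) (hz : ∀ i, z i ≠ 0)
    (hI : ∀ i j, ∀ W : Set K, IsValuationLocality W →
      (∃ v ∈ S i, v ⊆ W) → (∃ v ∈ S j, v ⊆ W) →
      x i - x j ∈ scale (z i) W ∧ scale (z i) W = scale (z j) W) :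
    ∃ a : K, ∀ i, ∀ v ∈ S i, (a - x i) / z i ∈ mball v := by
  have hval : ∀ i, S i ⊆ {O | IsValuationLocality O} := by
    intro i O hO
    obtain ⟨A, hA, -⟩ := hsub i hO
    exact ⟨A, hA⟩
  have hcomp : ∀ i, @IsCompact (Set K) (conTop K) (S i) := by
    intro i
    obtain ⟨C, hC, hSC⟩ := hT i
    rw [hSC]
    exact compact_of_closed hπ he hC
  let T : Fin n → Set (ValuationSubring K) := fun i => {v | (v : Set K) ∈ S i}
  have hcp : ∀ i, CpGood (T i) := by
    intro i
    have h := cpGood_of_compact (hcomp i)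
    have : {v : ValuationSubring K | (v : Set K) ∈ S i ∧ S i ⊆ {O | IsValuationLocality O}} = T i := by
      ext v; exact ⟨fun h => h.1, fun h => ⟨h, hval i⟩⟩
    rwa [this] at h
  have hcpU : CpGood (⋃ i, T i) := by
    have hc : @IsCompact (Set K) (conTop K) (⋃ i, S i) := by
      letI := conTop K
      exact isCompact_iUnion hcomp
    have h := cpGood_of_compact hc
    have : {v : ValuationSubring K | (v : Set K) ∈ (⋃ i, S i) ∧
        (⋃ i, S i) ⊆ {O | IsValuationLocality O}} = ⋃ i, T i := by
      ext v
      constructor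
      · rintro ⟨h, -⟩
        obtain ⟨i, hi⟩ := Set.mem_iUnion.1 h
        exact Set.mem_iUnion.2 ⟨i, hi⟩
      · intro h
        obtain ⟨i, hi⟩ := Set.mem_iUnion.1 h
        exact ⟨Set.mem_iUnion.2 ⟨i, hi⟩, Set.iUnion_subset hval⟩
    rwa [this] at h
  obtain ⟨a, ha⟩ := approx_main hπ T (fun i v hv => good_of_SPiE hπ he (hsub i hv)) hcp hcpU
    (fun i j hij v hv => hdisj i j hij _ hv) x z hz (by
      rintro i j W ⟨v, hv, hvW⟩ ⟨v', hv', hvW'⟩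
      obtain ⟨⟨s, hs, hxs⟩, -⟩ := hI i j W ⟨W, rfl⟩ ⟨v, hv, hvW⟩ ⟨v', hv', hvW'⟩
      rw [hxs, mul_div_cancel_left₀ _ (hz i)]
      exact hs)
  refine ⟨a, fun i O hO => ?_⟩
  obtain ⟨v, rfl⟩ := hval i hO
  rw [mem_mball_iff, map_div₀, div_lt_one₀ ((Valuation.pos_iff _).2 (hz i))]
  exact ha i v hO

end PaperApprox
end
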